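/- For Y > 0 and an integer r ≥ 1, let G(Y,r) = Σ_{d ≥ 1, gcd(d,r)=1} h(d)·∫₀^{Y/d²} ψ(v) dv. Then uniformly for Y ≥ 1 and r ≥ 1 one has G(Y,r) = C'·∏_{p∣r}(1 + p(p²−2)^{-1})^{-1}·Y^{1/2} + O(d(r)·Y^{1/3}), where C' = (ζ(3/2)/(2π))·∏_p (p³−3p+2)/(p(p²−2)) (product over all primes), d(r) is the number of divisors of r, and the implied constant is absolute. -/

import Mathlib

open scoped BigOperators

/-- The sawtooth function `ψ(v) = ⌊v⌋ − v + 1/2`. -/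
noncomputable def saw (v : ℝ) : ℝ := (⌊v⌋ : ℝ) - v + 1 / 2

/-- The multiplicative function `h(d) = μ(d)²·∏_{p∣d}(1 − 2p^{-2})^{-1}`. -/
noncomputable def hfun (d : ℕ) : ℝ :=
  ((ArithmeticFunction.moebius d : ℤ) : ℝ) ^ 2 *
    ∏ p ∈ d.primeFactors, (1 - 2 / (p : ℝ) ^ 2)⁻¹

/-- `G(Y,r) = Σ_{d ≥ 1, (d,r)=1} h(d)·∫₀^{Y/d²} ψ(v) dv`. -/
noncomputable def Gfun (Y : ℝ) (r : ℕ) : ℝ :=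
  ∑' d : ℕ, if 1 ≤ d ∧ Nat.Coprime d r then
      hfun d * ∫ v in (0 : ℝ)..(Y / (d : ℝ) ^ 2), saw v
    else 0

/-- The constant `C' = (ζ(3/2)/(2π))·∏_p (p³−3p+2)/(p(p²−2))`. -/
noncomputable def Cprime : ℝ :=
  ((riemannZeta (3 / 2)).re / (2 * Real.pi)) *
    ∏' p : Nat.Primes,
      ((((p : ℕ) : ℝ) ^ 3 - 3 * ((p : ℕ) : ℝ) + 2) /
        (((p : ℕ) : ℝ) * (((p : ℕ) : ℝ) ^ 2 - 2)))

noncomputable def Fs (x : ℝ) : ℝ := ∫ v in (0 : ℝ)..x, saw v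

open MeasureTheory Filter Topology Set

lemma saw_eq (v : ℝ) : saw v = 1 / 2 - Int.fract v := by
  unfold saw Int.fract; ring

lemma saw_abs (v : ℝ) : ‖saw v‖ ≤ 1 / 2 := by
  rw [saw_eq, Real.norm_eq_abs, abs_le]
  have := Int.fract_nonneg v
  have := Int.fract_lt_one v
  constructor <;> linarith

lemma saw_int (a b : ℝ) : IntervalIntegrable saw volume a b := by
  have hm : Measurable saw := by
    have : saw = fun v => 1 / 2 - Int.fract v := funext saw_eq
    rw [this]
    exact measurable_const.sub measurable_fract
  rw [intervalIntegrable_iff]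
  refine Measure.integrableOn_of_bounded (M := 1/2) ?_ hm.aestronglyMeasurable ?_
  · simp
  · exact Filter.Eventually.of_forall saw_abs

lemma Fs_lip (x y : ℝ) : |Fs x - Fs y| ≤ 1 / 2 * |x - y| := by
  unfold Fs
  rw [intervalIntegral.integral_interval_sub_left (saw_int _ _) (saw_int _ _)]
  exact intervalIntegral.norm_integral_le_of_norm_le_const fun v _ => saw_abs v

lemma Fs_zero : Fs 0 = 0 := by simp [Fs]

lemma Fs_unit {x : ℝ} (h0 : 0 ≤ x) (h1 : x ≤ 1) : Fs x = x * (1 - x) / 2 := by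
  have : Fs x = ∫ v in (0:ℝ)..x, (1/2 - v) := by
    unfold Fs
    refine intervalIntegral.integral_congr_ae ?_
    have : ∀ᵐ v : ℝ, v ≠ 1 := by
      simp [ae_iff]
    filter_upwards [this] with v hv hvx
    rw [uIoc_of_le h0] at hvx
    rw [saw_eq, Int.fract_eq_self.2 ⟨hvx.1.le, lt_of_le_of_ne (hvx.2.trans h1) hv⟩]
  rw [this, intervalIntegral.integral_sub (by simp) (by simp)]
  simp
  ring

lemma saw_per : Function.Periodic saw 1 := by
  intro x; simp [saw_eq]

lemma Fs_eq (x : ℝ) : Fs x = Int.fract x * (1 - Int.fract x) / 2 := by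
  rw [← Fs_unit (Int.fract_nonneg x) (Int.fract_lt_one x).le]
  have h1 : Fs x = Fs ⌊x⌋ + ∫ v in (⌊x⌋:ℝ)..x, saw v :=
    (intervalIntegral.integral_add_adjacent_intervals (saw_int _ _) (saw_int _ _)).symm
  have h2 : Fs ⌊x⌋ = 0 := by
    have := saw_per.intervalIntegral_add_zsmul_eq ⌊x⌋ 0 saw_int
    have h3 : ∫ v in (0:ℝ)..1, saw v = 0 := by
      have := Fs_unit zero_le_one le_rfl
      simpa [Fs] using this
    simpa [Fs, h3] using this
  have h4 : ∫ v in (⌊x⌋:ℝ)..x, saw v = Fs (Int.fract x) := by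
    have := intervalIntegral.integral_comp_add_right (a := 0) (b := Int.fract x) saw (⌊x⌋ : ℝ)
    rw [zero_add, Int.fract_add_floor] at this
    rw [← this]
    unfold Fs
    congr 1
    ext v
    simp [saw_eq]
  rw [h1, h2, h4, zero_add]

lemma Fs_nonneg (x : ℝ) : 0 ≤ Fs x := by
  rw [Fs_eq]
  have := Int.fract_nonneg x
  have := Int.fract_lt_one x
  have := mul_nonneg (Int.fract_nonneg x) (sub_nonneg.2 (Int.fract_lt_one x).le)
  linarith

lemma Fs_le (x : ℝ) : Fs x ≤ 1 / 8 := by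
  rw [Fs_eq]
  nlinarith [sq_nonneg (Int.fract x - 1/2)]

lemma Fs_le_self {x : ℝ} (hx : 0 ≤ x) : Fs x ≤ 1 / 2 * x := by
  have := Fs_lip x 0
  rw [Fs_zero, sub_zero, sub_zero, abs_of_nonneg hx] at this
  exact (le_abs_self _).trans this

lemma Fs_cont : Continuous Fs := by
  have : LipschitzWith (1/2) Fs := LipschitzWith.of_dist_le_mul fun x y => by
    simpa [Real.dist_eq] using Fs_lip x y
  exact this.continuous

/-- Fourier expansion. -/
lemma Fs_fourier (x : ℝ) : HasSum (fun n : ℕ => 1 / (2 * Real.pi ^ 2) *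
    ((1 - Real.cos (2 * Real.pi * n * x)) / (n : ℝ) ^ 2)) (Fs x) := by
  have h0 := hasSum_one_div_nat_pow_mul_cos one_ne_zero
    (x := 0) ⟨le_rfl, zero_le_one⟩
  have h1 := hasSum_one_div_nat_pow_mul_cos one_ne_zero
    (x := Int.fract x) ⟨Int.fract_nonneg x, (Int.fract_lt_one x).le⟩
  have h := ((h0.sub h1).mul_left (1 / (2 * Real.pi ^ 2)))
  convert! h using 1
  · ext n
    have : Real.cos (2 * Real.pi * n * x) = Real.cos (2 * Real.pi * n * Int.fract x) := by
      rw [← Real.cos_sub_int_mul_two_pi _ (n * ⌊x⌋)]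
      congr 1
      unfold Int.fract
      push_cast
      ring
    rw [this]
    simp
    ring
  · rw [Fs_eq]
    have hB : ∀ y : ℝ, ((Polynomial.bernoulli (2*1)).map (algebraMap ℚ ℝ)).eval y
        = y^2 - y + 1/6 := by
      intro y
      simp [Polynomial.bernoulli, Finset.sum_range_succ, Polynomial.eval_add, bernoulli_one,
        bernoulli_two, bernoulli_zero]
      ring
    rw [hB, hB]
    have := Real.pi_ne_zero
    simp
    field_simp
    ring

lemma one_sub_cexp_bound {w : ℂ} (hw : 0 ≤ w.re) (x : ℝ) (hx : 0 < x) :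
    ‖(1 - Complex.exp (-w * (x:ℂ)^2)) / (x:ℂ)^2‖ ≤ 2 * (1 + ‖w‖) * (1 + x^2)⁻¹ := by
  have hn : ‖-w * (x:ℂ)^2‖ = ‖w‖ * x^2 := by
    simp
  have h2 : ‖1 - Complex.exp (-w * (x:ℂ)^2)‖ ≤ 2 := by
    refine (norm_sub_le _ _).trans ?_
    have : ‖Complex.exp (-w * (x:ℂ)^2)‖ ≤ 1 := by
      rw [Complex.norm_exp]
      apply Real.exp_le_one_iff.2
      rw [← Complex.ofReal_pow, Complex.re_mul_ofReal]
      simp only [Complex.neg_re]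
      nlinarith [mul_nonneg hw (sq_nonneg x)]
    simp only [norm_one]; linarith
  have h1 : ‖1 - Complex.exp (-w * (x:ℂ)^2)‖ ≤ 2 * (‖w‖ * x^2) := by
    by_cases h : ‖-w * (x:ℂ)^2‖ ≤ 1
    · rw [norm_sub_rev, ← hn]
      exact Complex.norm_exp_sub_one_le h
    · rw [hn] at h
      linarith
  have hx2 : 0 < x^2 := by positivity
  rw [norm_div, norm_pow, Complex.norm_real, Real.norm_eq_abs, sq_abs, ← div_eq_mul_inv,
    div_le_div_iff₀ hx2 (by positivity)]
  nlinarith [norm_nonneg w, norm_nonneg (1 - Complex.exp (-w * (x:ℂ)^2))]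

lemma meas_aux (w : ℂ) : AEStronglyMeasurable (fun x : ℝ => (1 - Complex.exp (-w * (x:ℂ)^2)) / (x:ℂ)^2)
    (volume.restrict (Ioi 0)) := by
  apply Measurable.aestronglyMeasurable
  fun_prop

lemma int_aux {w : ℂ} (hw : 0 ≤ w.re) :
    IntegrableOn (fun x : ℝ => (1 - Complex.exp (-w * (x:ℂ)^2)) / (x:ℂ)^2) (Ioi 0) := by
  refine Integrable.mono' ((integrable_inv_one_add_sq.const_mul (2 * (1 + ‖w‖))).integrableOn)
    (meas_aux w) ?_
  refine (ae_restrict_iff' measurableSet_Ioi).2 (Eventually.of_forall fun x hx => ?_)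
  exact one_sub_cexp_bound hw x hx

lemma phi_pos {z : ℂ} (hz : 0 < z.re) :
    ∫ x : ℝ in Ioi 0, (1 - Complex.exp (-z * (x:ℂ)^2)) / (x:ℂ)^2 =
      z * (Real.pi / z) ^ (1/2 : ℂ) := by
  have hu : ∀ x ∈ Ioi (0:ℝ), HasDerivAt (fun x : ℝ => 1 - Complex.exp (-z * (x:ℂ)^2))
      (2 * z * x * Complex.exp (-z * (x:ℂ)^2)) x := by
    intro x _
    have h1 : HasDerivAt (fun x : ℝ => (x:ℂ)) 1 x := Complex.ofRealCLM.hasDerivAt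
    have := (((h1.pow 2).const_mul (-z)).cexp).const_sub 1
    convert! this using 1
    simp only [Pi.pow_apply]
    push_cast
    ring
  have hv : ∀ x ∈ Ioi (0:ℝ), HasDerivAt (fun x : ℝ => -((x:ℂ))⁻¹) (1 / (x:ℂ)^2) x := by
    intro x hx
    have h1 : HasDerivAt (fun x : ℝ => (x:ℂ)) 1 x := Complex.ofRealCLM.hasDerivAt
    have hx0 : (x:ℂ) ≠ 0 := by exact_mod_cast (ne_of_gt hx)
    have := (h1.inv hx0).neg
    convert! this using 1
    ring
  have hgi : IntegrableOn (fun x : ℝ => Complex.exp (-z * (x:ℂ)^2)) (Ioi 0) :=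
    (integrable_cexp_neg_mul_sq hz).integrableOn
  have heq : EqOn (fun x : ℝ => (-(2 * z)) * Complex.exp (-z * (x:ℂ)^2))
      ((fun x : ℝ => 2 * z * x * Complex.exp (-z * (x:ℂ)^2)) * (fun x : ℝ => -((x:ℂ))⁻¹))
      (Ioi 0) := by
    intro x hx
    have hx0 : (x:ℂ) ≠ 0 := by exact_mod_cast (ne_of_gt hx)
    simp only [Pi.mul_apply]
    field_simp
  have hu0 : ∀ x : ℝ, 0 < x → ‖((fun x : ℝ => 1 - Complex.exp (-z * (x:ℂ)^2)) *
      (fun x : ℝ => -((x:ℂ))⁻¹)) x‖ ≤ 2 * (1 + ‖z‖) * (x * (1 + x^2)⁻¹) := by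
    intro x hx
    have h := one_sub_cexp_bound hz.le x hx
    have hx0 : (x:ℂ) ≠ 0 := by exact_mod_cast (ne_of_gt hx)
    have e : ((fun x : ℝ => 1 - Complex.exp (-z * (x:ℂ)^2)) * (fun x : ℝ => -((x:ℂ))⁻¹)) x =
      -((x:ℂ) * ((1 - Complex.exp (-z * (x:ℂ)^2)) / (x:ℂ)^2)) := by
      simp only [Pi.mul_apply]
      field_simp
    rw [e, norm_neg, norm_mul, Complex.norm_real, Real.norm_eq_abs, abs_of_pos hx]
    nlinarith [mul_le_mul_of_nonneg_left h hx.le]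
  have key := integral_Ioi_mul_deriv_eq_deriv_mul (a := 0) (a' := 0) (b' := 0) hu hv ?_ ?_ ?_ ?_
  · have : ∀ x : ℝ, (1 - Complex.exp (-z * (x:ℂ)^2)) / (x:ℂ)^2 =
      (1 - Complex.exp (-z * (x:ℂ)^2)) * (1 / (x:ℂ)^2) := fun x => by ring
    simp only [this]
    have hh := setIntegral_congr_fun (μ := volume) measurableSet_Ioi heq
    simp only [Pi.mul_apply] at hh
    rw [key, ← hh, integral_const_mul,
      integral_gaussian_complex_Ioi hz]
    ring
  · convert! int_aux hz.le using 2 with x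
    simp [div_eq_mul_inv]
  · exact IntegrableOn.congr_fun (hgi.const_mul _) heq measurableSet_Ioi
  · have : Tendsto (fun x : ℝ => 2 * (1 + ‖z‖) * (x * (1 + x^2)⁻¹)) (𝓝[>] 0) (𝓝 0) := by
      have : ContinuousAt (fun x : ℝ => 2 * (1 + ‖z‖) * (x * (1 + x^2)⁻¹)) 0 := by
        have : (1:ℝ) + 0^2 ≠ 0 := by norm_num
        fun_prop (disch := assumption)
      have h := this.tendsto.mono_left (nhdsWithin_le_nhds (s := Ioi 0))
      simpa using h
    exact squeeze_zero_norm' (eventually_nhdsWithin_of_forall hu0) this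
  · have h1 : Tendsto (fun x : ℝ => 2 * (1 + ‖z‖) * x⁻¹) atTop (𝓝 0) := by
      simpa using tendsto_inv_atTop_zero.const_mul (2 * (1 + ‖z‖))
    refine squeeze_zero_norm' ?_ h1
    filter_upwards [eventually_gt_atTop 0] with x hx
    refine (hu0 x hx).trans ?_
    gcongr
    rw [← div_eq_mul_inv, div_le_iff₀ (by positivity)]
    field_simp
    nlinarith

lemma phi_im {b : ℝ} (hb : 0 < b) :
    ∫ x : ℝ in Ioi 0, (1 - Complex.exp (-((b:ℂ) * Complex.I) * (x:ℂ)^2)) / (x:ℂ)^2 =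
      (b * Complex.I) * (Real.pi / (b * Complex.I)) ^ (1/2 : ℂ) := by
  have hbI : (b:ℂ) * Complex.I ≠ 0 := by
    simp [hb.ne']
  let zf : ℝ → ℂ := fun e => (e:ℂ) + b * Complex.I
  have hzt : Tendsto zf (𝓝[>] 0) (𝓝 (b * Complex.I)) := by
    have : Continuous zf := by fun_prop
    have h := (this.tendsto 0).mono_left (nhdsWithin_le_nhds (s := Ioi 0))
    simpa [zf] using h
  have hR : Tendsto (fun e => zf e * (Real.pi / zf e) ^ (1/2 : ℂ)) (𝓝[>] 0)
      (𝓝 ((b * Complex.I) * (Real.pi / (b * Complex.I)) ^ (1/2 : ℂ))) := by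
    have hc : ContinuousAt (fun z : ℂ => z * (Real.pi / z) ^ (1/2 : ℂ)) (b * Complex.I) := by
      apply continuousAt_id.mul
      refine ContinuousAt.cpow (continuousAt_const.div continuousAt_id hbI) continuousAt_const ?_
      right
      have : (Real.pi / (b * Complex.I) : ℂ) = -((Real.pi / b : ℝ) : ℂ) * Complex.I := by
        have : (b:ℂ) ≠ 0 := by exact_mod_cast hb.ne'
        push_cast
        rw [mul_comm (b:ℂ), ← div_div, Complex.div_I]
        ring
      rw [this]
      simp [Real.pi_ne_zero, hb.ne']
    exact hc.tendsto.comp hzt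
  have hL : Tendsto (fun e => ∫ x : ℝ in Ioi 0, (1 - Complex.exp (-(zf e) * (x:ℂ)^2)) / (x:ℂ)^2)
      (𝓝[>] 0) (𝓝 (∫ x : ℝ in Ioi 0,
        (1 - Complex.exp (-((b:ℂ) * Complex.I) * (x:ℂ)^2)) / (x:ℂ)^2)) := by
    refine tendsto_integral_filter_of_dominated_convergence
      (fun x => 2 * (1 + (1 + b)) * (1 + x^2)⁻¹) ?_ ?_ ?_ ?_
    · exact Eventually.of_forall fun e => meas_aux _
    · have : ∀ᶠ e : ℝ in 𝓝[>] 0, e ∈ Ioo (0:ℝ) 1 := Ioo_mem_nhdsGT one_pos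
      filter_upwards [this] with e he
      refine (ae_restrict_iff' measurableSet_Ioi).2 (Eventually.of_forall fun x hx => ?_)
      refine (one_sub_cexp_bound (by simp [zf, he.1.le]) x hx).trans ?_
      gcongr
      refine (norm_add_le _ _).trans ?_
      simp [abs_of_pos hb, abs_of_pos he.1, he.2.le]
    · exact (integrable_inv_one_add_sq.const_mul _).integrableOn
    · refine Eventually.of_forall fun x => ?_
      have : Continuous fun z : ℂ => (1 - Complex.exp (-z * (x:ℂ)^2)) / (x:ℂ)^2 := by fun_prop
      exact (this.tendsto _).comp hzt
  refine tendsto_nhds_unique hL (hR.congr' ?_)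
  refine eventually_nhdsWithin_of_forall fun e he => ?_
  exact (phi_pos (by simpa [zf] using he)).symm

lemma phi_re_eq (b x : ℝ) : ((1 - Complex.exp (-((b:ℂ) * Complex.I) * (x:ℂ)^2)) / (x:ℂ)^2).re
    = (1 - Real.cos (b * x^2)) / x^2 := by
  rw [← Complex.ofReal_pow, Complex.div_ofReal_re, Complex.sub_re, Complex.one_re]
  rw [show -((b:ℂ) * Complex.I) * ((x^2 : ℝ) : ℂ) = ((-(b * x^2) : ℝ) : ℂ) * Complex.I by
    push_cast; ring]
  rw [Complex.exp_ofReal_mul_I_re, Real.cos_neg]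

lemma cos_int {b : ℝ} (hb : 0 < b) :
    IntegrableOn (fun x : ℝ => (1 - Real.cos (b * x^2)) / x^2) (Ioi 0) ∧
    ∫ x : ℝ in Ioi 0, (1 - Real.cos (b * x^2)) / x^2 = √(Real.pi * b / 2) := by
  have hi := int_aux (w := (b:ℂ) * Complex.I) (by simp)
  constructor
  · have := hi.re
    refine this.congr ?_
    refine Eventually.of_forall fun x => ?_
    exact phi_re_eq b x
  · have h := congrArg Complex.re (phi_im hb)
    have h2 := integral_re hi
    simp only [RCLike.re_eq_complex_re, phi_re_eq] at h2
    rw [h2, h]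
    set s := √(Real.pi / (2 * b)) with hs
    have hs0 : 0 < s := Real.sqrt_pos.2 (by positivity)
    have hs2 : s ^ 2 = Real.pi / (2 * b) := Real.sq_sqrt (by positivity)
    have e1 : (Real.pi / (b * Complex.I) : ℂ) = ((s:ℂ) * (1 - Complex.I))^2 := by
      rw [mul_pow, ← Complex.ofReal_pow, hs2, sub_sq, Complex.I_sq]
      have : (b:ℂ) ≠ 0 := by exact_mod_cast hb.ne'
      rw [mul_comm (b:ℂ), ← div_div, Complex.div_I]
      push_cast
      field_simp
      ring
    rw [e1, one_div, Complex.sq_cpow_two_inv (by simpa using hs0)]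
    have e2 : ((b:ℂ) * Complex.I * (s * (1 - Complex.I))).re = b * s := by
      simp
    rw [e2]
    symm
    rw [Real.sqrt_eq_iff_mul_self_eq (by positivity) (by positivity)]
    have : b * s * (b * s) = b^2 * s^2 := by ring
    rw [this, hs2]
    field_simp

noncomputable def Kc : ℝ := (riemannZeta (3 / 2)).re / (2 * Real.pi)

lemma zeta_hasSum : HasSum (fun n : ℕ => 1 / (n:ℝ) ^ (3/2 : ℝ)) (riemannZeta (3/2)).re := by
  have hs : Summable (fun n : ℕ => 1 / (n:ℝ) ^ (3/2 : ℝ)) :=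
    Real.summable_one_div_nat_rpow.2 (by norm_num)
  have h := zeta_eq_tsum_one_div_nat_cpow (s := 3/2) (by norm_num)
  have e : ∀ n : ℕ, (1 / (n:ℂ) ^ (3/2 : ℂ)) = ((1 / (n:ℝ) ^ (3/2 : ℝ) : ℝ) : ℂ) := by
    intro n
    rw [Complex.ofReal_div, Complex.ofReal_cpow (by positivity)]
    norm_num
  simp only [e] at h
  rw [h, ← Complex.ofReal_tsum, Complex.ofReal_re]
  exact hs.hasSum

lemma Fs_int_K : ∫ x : ℝ in Ioi 0, Fs (x^2) / x^2 = Kc := by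
  let T : ℕ → ℝ → ℝ := fun n x => 1 / (2 * Real.pi ^ 2) *
    ((1 - Real.cos (2 * Real.pi * n * x^2)) / (n : ℝ) ^ 2) / x^2
  have hT : ∀ n x, T n x = 1 / (2 * Real.pi ^ 2) / (n:ℝ)^2 *
      ((1 - Real.cos (2 * Real.pi * n * x^2)) / x^2) := by
    intro n x; simp only [T]; ring
  have hTn : ∀ n x, 0 ≤ T n x := by
    intro n x
    rw [hT]
    have := Real.cos_le_one (2 * Real.pi * n * x^2)
    have : 0 ≤ 1 - Real.cos (2 * Real.pi * n * x^2) := by linarith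
    positivity
  have hval : ∀ n, IntegrableOn (T n) (Ioi 0) ∧
      ∫ x in Ioi 0, T n x = 1 / (2 * Real.pi) * (1 / (n:ℝ) ^ (3/2 : ℝ)) := by
    intro n
    rcases Nat.eq_zero_or_pos n with rfl | hn
    · have : T 0 = fun _ => 0 := by ext x; simp [T]
      rw [this]
      have h0 : (0:ℝ) ^ (3/2:ℝ) = 0 := Real.zero_rpow (by norm_num)
      simp [h0]
    · have hn' : (0:ℝ) < n := by exact_mod_cast hn
      obtain ⟨h1, h2⟩ := cos_int (b := 2 * Real.pi * n) (by positivity)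
      have hTe : T n = fun x => 1 / (2 * Real.pi ^ 2) / (n:ℝ)^2 *
      ((1 - Real.cos (2 * Real.pi * n * x^2)) / x^2) := funext (hT n)
      rw [hTe]
      refine ⟨h1.const_mul _, ?_⟩
      rw [integral_const_mul, h2]
      have e1 : √(Real.pi * (2 * Real.pi * n) / 2) = Real.pi * √n := by
        rw [show Real.pi * (2 * Real.pi * n) / 2 = Real.pi^2 * n by ring,
          Real.sqrt_mul (by positivity), Real.sqrt_sq Real.pi_pos.le]
      have e2 : (n:ℝ) ^ (3/2 : ℝ) = n * √n := by
        rw [show (3/2 : ℝ) = 1 + 1/2 by norm_num, Real.rpow_add hn', Real.rpow_one,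
          Real.sqrt_eq_rpow]
      have hsn : √(n:ℝ) ^ 2 = n := Real.sq_sqrt hn'.le
      have hs0 : 0 < √(n:ℝ) := Real.sqrt_pos.2 hn'
      rw [e1, e2]
      have := Real.pi_pos
      field_simp
      rw [hsn]
  have hnorm : ∀ n, ∫ x in Ioi 0, ‖T n x‖ = 1 / (2 * Real.pi) * (1 / (n:ℝ) ^ (3/2 : ℝ)) := by
    intro n
    rw [← (hval n).2]
    congr 1; ext x
    exact Real.norm_of_nonneg (hTn n x)
  have hz := zeta_hasSum.mul_left (1 / (2 * Real.pi))
  have h := hasSum_integral_of_summable_integral_norm (μ := volume.restrict (Ioi 0))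
    (fun n => (hval n).1) (by simp only [hnorm]; exact hz.summable)
  simp only [fun n => (hval n).2] at h
  have hts : ∀ x : ℝ, ∑' n, T n x = Fs (x^2) / x^2 := by
    intro x
    exact ((Fs_fourier (x^2)).div_const (x^2)).tsum_eq
  simp only [hts] at h
  rw [h.unique hz, Kc]
  ring

lemma Fs_int_X {X : ℝ} (hX : 0 < X) : ∫ t : ℝ in Ioi 0, Fs (X / t^2) = Kc * √X := by
  rw [← integral_comp_rpow_Ioi (fun t => Fs (X / t^2)) (p := -1) (by norm_num)]
  have hs : 0 < √X := Real.sqrt_pos.2 hX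
  have hs2 : √X ^ 2 = X := Real.sq_sqrt hX.le
  have h := integral_comp_mul_left_Ioi (fun x => Fs (x^2) / x^2) 0 hs
  rw [mul_zero, Fs_int_K] at h
  have : ∀ x ∈ Ioi (0:ℝ), (|(-1:ℝ)| * x ^ ((-1:ℝ) - 1)) • Fs (X / (x ^ (-1:ℝ))^2)
      = X * (Fs ((√X * x)^2) / (√X * x)^2) := by
    intro x hx
    have hx : 0 < x := hx
    rw [show ((-1:ℝ) - 1) = -(2:ℕ) by norm_num, Real.rpow_neg hx.le, Real.rpow_natCast,
      Real.rpow_neg_one, mul_pow, hs2]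
    simp only [abs_neg, abs_one, one_mul, smul_eq_mul, inv_pow, div_inv_eq_mul]
    field_simp
  rw [setIntegral_congr_fun measurableSet_Ioi this, integral_const_mul, h, smul_eq_mul]
  field_simp
  rw [hs2]

noncomputable def Sx (X : ℝ) : ℝ := ∑' m : ℕ, Fs (X / (m:ℝ)^2)

lemma Fs_div_le {X : ℝ} (hX : 0 ≤ X) (m : ℝ) : Fs (X / m^2) ≤ X / 2 * (1 / m^2) := by
  refine (Fs_le_self (by positivity)).trans (le_of_eq (by ring))

lemma Sx_summable {X : ℝ} (hX : 0 ≤ X) : Summable fun m : ℕ => Fs (X / (m:ℝ)^2) := by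
  refine Summable.of_nonneg_of_le (fun m => Fs_nonneg _) (fun m => Fs_div_le hX m) ?_
  exact (Real.summable_one_div_nat_pow.2 (by norm_num)).mul_left _

lemma Sx_nonneg (X : ℝ) : 0 ≤ Sx X := tsum_nonneg fun _ => Fs_nonneg _

noncomputable def z2 : ℝ := ∑' m : ℕ, 1 / (m:ℝ)^2

lemma z2_nonneg : 0 ≤ z2 := tsum_nonneg fun _ => by positivity

lemma Sx_le {X : ℝ} (hX : 0 ≤ X) : Sx X ≤ X / 2 * z2 := by
  unfold Sx z2
  rw [← tsum_mul_left]
  exact (Sx_summable hX).tsum_le_tsum (fun m => Fs_div_le hX m)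
    ((Real.summable_one_div_nat_pow.2 (by norm_num)).mul_left _)

lemma fX_int {X : ℝ} (hX : 0 ≤ X) : Integrable fun t : ℝ => Fs (X / t^2) := by
  refine Integrable.mono' (integrable_inv_one_add_sq.const_mul (1/8 + X/2)) ?_ ?_
  · apply Measurable.aestronglyMeasurable
    exact Fs_cont.measurable.comp (by fun_prop)
  · refine Eventually.of_forall fun t => ?_
    rw [Real.norm_of_nonneg (Fs_nonneg _), ← div_eq_mul_inv, le_div_iff₀ (by positivity)]
    have h1 := Fs_le (X / t^2)
    have h2 : Fs (X / t^2) * t^2 ≤ X / 2 := by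
      by_cases ht : t = 0
      · subst ht; simp; linarith
      · have := Fs_div_le hX t
        have ht2 : 0 < t^2 := by positivity
        calc _ ≤ (X / 2 * (1 / t^2)) * t^2 := by gcongr
          _ = X / 2 := by field_simp
    linarith

lemma step_gen {X : ℝ} (hX : 0 ≤ X) (m : ℕ) {B : ℝ}
    (hB : ∀ t ∈ Ioc (m:ℝ) (m+1), |Fs (X / ((m:ℝ)+1)^2) - Fs (X / t^2)| ≤ B) :
    |Fs (X / ((m:ℝ)+1)^2) - ∫ t in (m:ℝ)..(m+1:ℕ), Fs (X / t^2)| ≤ B := by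
  push_cast
  have h1 : Fs (X / ((m:ℝ)+1)^2) = ∫ t in (m:ℝ)..(m+1), Fs (X / ((m:ℝ)+1)^2) := by simp
  rw [h1, ← intervalIntegral.integral_sub (by simp) (fX_int hX).intervalIntegrable]
  have := intervalIntegral.norm_integral_le_of_norm_le_const (a := (m:ℝ)) (b := m+1)
    (f := fun t => Fs (X / ((m:ℝ)+1)^2) - Fs (X / t^2)) (C := B) (by
      intro t ht
      rw [uIoc_of_le (by linarith)] at ht
      exact hB t ht)
  simpa using this

lemma step1 {X : ℝ} (hX : 0 ≤ X) (m : ℕ) :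
    |Fs (X / ((m:ℝ)+1)^2) - ∫ t in (m:ℝ)..(m+1:ℕ), Fs (X / t^2)| ≤ 1/8 := by
  refine step_gen hX m fun t _ => ?_
  have := Fs_nonneg (X / ((m:ℝ)+1)^2)
  have := Fs_le (X / ((m:ℝ)+1)^2)
  have := Fs_nonneg (X / t^2)
  have := Fs_le (X / t^2)
  rw [abs_le]; constructor <;> linarith

lemma step2 {X : ℝ} (hX : 0 ≤ X) (m : ℕ) (hm : 1 ≤ m) :
    |Fs (X / ((m:ℝ)+1)^2) - ∫ t in (m:ℝ)..(m+1:ℕ), Fs (X / t^2)| ≤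
      1/2 * (X / (m:ℝ)^2 - X / ((m:ℝ)+1)^2) := by
  have hm' : (0:ℝ) < m := by exact_mod_cast hm
  refine step_gen hX m fun t ht => ?_
  have ht0 : 0 < t := hm'.trans ht.1
  refine (Fs_lip _ _).trans ?_
  have h1 : X / ((m:ℝ)+1)^2 ≤ X / t^2 := by
    have := ht.2
    gcongr
  have h2 : X / t^2 ≤ X / (m:ℝ)^2 := by
    have := ht.1.le
    gcongr
  rw [abs_sub_comm, abs_of_nonneg (by linarith)]
  linarith

lemma sum_bound {X : ℝ} (hX : 0 ≤ X) (M : ℕ) (hM : 1 ≤ M) (j : ℕ) :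
    ∑ m ∈ Finset.range (j + M), |Fs (X / ((m:ℝ)+1)^2) - ∫ t in (m:ℝ)..(m+1:ℕ), Fs (X / t^2)|
      ≤ M / 8 + 1/2 * (X / (M:ℝ)^2 - X / ((j+M : ℕ):ℝ)^2) := by
  induction j with
  | zero =>
    simp only [zero_add, sub_self, mul_zero, add_zero]
    refine (Finset.sum_le_sum fun m _ => step1 hX m).trans ?_
    simp
    linarith
  | succ j ih =>
    rw [show j + 1 + M = (j + M) + 1 by ring, Finset.sum_range_succ]
    have := step2 hX (j + M) (by omega)
    push_cast at *
    linarith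

lemma Sx_err0 {X : ℝ} (hX : 0 < X) (M : ℕ) (hM : 1 ≤ M) :
    |Sx X - Kc * √X| ≤ M / 8 + 1/2 * (X / (M:ℝ)^2) := by
  have hs := Sx_summable hX.le
  have hS : Sx X = ∑' m : ℕ, Fs (X / ((m:ℝ)+1)^2) := by
    unfold Sx
    rw [hs.tsum_eq_zero_add]
    simp [Fs_zero]
  have hs' : Summable fun m : ℕ => Fs (X / ((m:ℝ)+1)^2) := by
    have := (summable_nat_add_iff 1).2 hs
    simpa using this
  have h1 := hs'.hasSum.tendsto_sum_nat
  rw [← hS] at h1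
  have h2 := intervalIntegral_tendsto_integral_Ioi 0 (fX_int hX.le).integrableOn
    (tendsto_natCast_atTop_atTop (R := ℝ))
  rw [Fs_int_X hX] at h2
  have h3 := ((tendsto_add_atTop_iff_nat M).2 (h1.sub h2)).abs
  refine le_of_tendsto h3 (Eventually.of_forall fun j => ?_)
  have h4 : ∫ t in (0:ℝ)..((j + M : ℕ):ℝ), Fs (X / t^2) =
      ∑ m ∈ Finset.range (j + M), ∫ t in (m:ℝ)..(m+1:ℕ), Fs (X / t^2) := by
    rw [intervalIntegral.sum_integral_adjacent_intervals (a := fun k : ℕ => (k:ℝ))]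
    · simp
    · intro k _
      exact (fX_int hX.le).intervalIntegrable
  rw [h4, ← Finset.sum_sub_distrib]
  refine (Finset.abs_sum_le_sum_abs _ _).trans ((sum_bound hX.le M hM j).trans ?_)
  have : 0 ≤ X / ((j+M : ℕ):ℝ)^2 := by positivity
  linarith

lemma Sx_err : ∃ C : ℝ, 0 < C ∧ ∀ X : ℝ, 0 < X → |Sx X - Kc * √X| ≤ C * X ^ (1/3 : ℝ) := by
  refine ⟨1 + z2 + |Kc|, by have := z2_nonneg; positivity, fun X hX => ?_⟩
  have hz := z2_nonneg
  set c := X ^ (1/3 : ℝ) with hc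
  have hc0 : 0 < c := Real.rpow_pos_of_pos hX _
  have hc3 : c ^ 3 = X := by
    rw [hc, ← Real.rpow_natCast, ← Real.rpow_mul hX.le]; norm_num
  by_cases h : 1 ≤ X
  · have hc1 : 1 ≤ c := Real.one_le_rpow h (by norm_num)
    have hM : c ≤ ⌈c⌉₊ := Nat.le_ceil c
    have hM2 : (⌈c⌉₊ : ℝ) < c + 1 := Nat.ceil_lt_add_one hc0.le
    have h1 := Sx_err0 hX ⌈c⌉₊ (Nat.one_le_ceil_iff.2 hc0)
    have h2 : X / (⌈c⌉₊ : ℝ)^2 ≤ c := by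
      calc X / (⌈c⌉₊ : ℝ)^2 ≤ X / c^2 := by gcongr
        _ = c := by rw [← hc3]; field_simp
    have h3 : 0 ≤ (z2 + |Kc|) * c := by positivity
    nlinarith
  · push Not at h
    have h1 := Sx_le hX.le
    have h0 := Sx_nonneg X
    have hXc : X ≤ c := by
      calc X = X ^ (1:ℝ) := (Real.rpow_one X).symm
        _ ≤ _ := Real.rpow_le_rpow_of_exponent_ge hX h.le (by norm_num)
    have hsc : √X ≤ c := by
      rw [Real.sqrt_eq_rpow]
      exact Real.rpow_le_rpow_of_exponent_ge hX h.le (by norm_num)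
    calc |Sx X - Kc * √X| ≤ |Sx X| + |Kc * √X| := abs_sub _ _
      _ = Sx X + |Kc| * √X := by rw [abs_of_nonneg h0, abs_mul, abs_of_nonneg (Real.sqrt_nonneg X)]
      _ ≤ c * z2 + |Kc| * c := by
        have : X / 2 * z2 ≤ c * z2 := by gcongr; linarith
        have : |Kc| * √X ≤ |Kc| * c := by gcongr
        linarith
      _ ≤ _ := by nlinarith

lemma hfun_zero : hfun 0 = 0 := by simp [hfun]
lemma hfun_one : hfun 1 = 1 := by simp [hfun]

lemma hfun_mul {m n : ℕ} (h : m.Coprime n) : hfun (m * n) = hfun m * hfun n := by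
  unfold hfun
  rw [ArithmeticFunction.isMultiplicative_moebius.map_mul_of_coprime h, h.primeFactors_mul,
    Finset.prod_union h.disjoint_primeFactors]
  push_cast
  ring

lemma hfun_prime {p : ℕ} (hp : p.Prime) : hfun p = (1 - 2 / (p:ℝ)^2)⁻¹ := by
  unfold hfun
  rw [ArithmeticFunction.moebius_apply_prime hp, hp.primeFactors]
  simp

lemma hfun_prime_pow {p : ℕ} (hp : p.Prime) (e : ℕ) : hfun (p ^ (e + 2)) = 0 := by
  unfold hfun
  rw [ArithmeticFunction.moebius_apply_prime_pow hp (by omega)]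
  simp

noncomputable def Hr (r : ℕ) : ArithmeticFunction ℝ :=
  ⟨fun d => if d.Coprime r then hfun d else 0, by simp [hfun_zero]⟩

lemma Hr_apply (r d : ℕ) : Hr r d = if d.Coprime r then hfun d else 0 := rfl

lemma Hr_mult (r : ℕ) : (Hr r).IsMultiplicative := by
  refine ⟨by simp [Hr_apply, hfun_one], fun {m n} h => ?_⟩
  simp only [Hr_apply, Nat.coprime_mul_iff_left, hfun_mul h]
  by_cases h1 : m.Coprime r
  · by_cases h2 : n.Coprime r
    · rw [if_pos ⟨h1, h2⟩, if_pos h1, if_pos h2]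
    · rw [if_neg (fun h => h2 h.2), if_neg h2, mul_zero]
  · rw [if_neg (fun h => h1 h.1), if_neg h1, zero_mul]

lemma Hr_prime (r : ℕ) {p : ℕ} (hp : p.Prime) :
    Hr r p = if p ∣ r then 0 else (1 - 2 / (p:ℝ)^2)⁻¹ := by
  rw [Hr_apply, hfun_prime hp]
  have := hp.coprime_iff_not_dvd (n := r)
  by_cases h : p ∣ r <;> simp [this, h]

lemma Hr_prime_pow (r : ℕ) {p : ℕ} (hp : p.Prime) (e : ℕ) : Hr r (p ^ (e+2)) = 0 := by
  rw [Hr_apply, hfun_prime_pow hp]; simp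

noncomputable def gr (r : ℕ) : ArithmeticFunction ℝ :=
  Hr r * ((ArithmeticFunction.moebius : ArithmeticFunction ℤ) : ArithmeticFunction ℝ)

lemma gr_mult (r : ℕ) : (gr r).IsMultiplicative :=
  (Hr_mult r).mul ArithmeticFunction.isMultiplicative_moebius.intCast

lemma gr_zeta (r : ℕ) : gr r * ((ArithmeticFunction.zeta : ArithmeticFunction ℕ) :
    ArithmeticFunction ℝ) = Hr r := by
  unfold gr
  rw [mul_assoc, ArithmeticFunction.coe_moebius_mul_coe_zeta, mul_one]

lemma gr_sum (r n : ℕ) : ∑ k ∈ n.divisors, gr r k = Hr r n := by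
  rw [← gr_zeta r, ArithmeticFunction.coe_mul_zeta_apply]

lemma gr_succ (r : ℕ) {p : ℕ} (hp : p.Prime) (e : ℕ) :
    gr r (p ^ (e+1)) = Hr r (p ^ (e+1)) - Hr r (p ^ e) := by
  rw [← gr_sum, ← gr_sum, Nat.sum_divisors_prime_pow hp, Nat.sum_divisors_prime_pow hp,
    Finset.sum_range_succ _ (e+1)]
  ring

lemma gr_p1 (r : ℕ) {p : ℕ} (hp : p.Prime) : gr r (p ^ 1) = Hr r p - 1 := by
  have := gr_succ r hp 0
  simpa [(Hr_mult r).1] using this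

lemma gr_p2 (r : ℕ) {p : ℕ} (hp : p.Prime) : gr r (p ^ 2) = - Hr r p := by
  have := gr_succ r hp 1
  have h2 := Hr_prime_pow r hp 0
  simpa [h2] using this

lemma gr_p3 (r : ℕ) {p : ℕ} (hp : p.Prime) (e : ℕ) : gr r (p ^ (e+3)) = 0 := by
  have := gr_succ r hp (e+2)
  rw [this, Hr_prime_pow r hp e, Hr_prime_pow r hp (e+1)]; simp

lemma gr_tsum (r : ℕ) {p : ℕ} (hp : p.Prime) (φ : ℝ → ℕ → ℝ) (hφ : ∀ n, φ 0 n = 0) :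
    HasSum (fun e => φ (gr r (p^e)) (p^e))
      (φ 1 1 + φ (Hr r p - 1) p + φ (- Hr r p) (p^2)) := by
  have h : HasSum (fun e => φ (gr r (p^e)) (p^e))
      (∑ e ∈ Finset.range 3, φ (gr r (p^e)) (p^e)) :=
    hasSum_sum_of_ne_finset_zero (fun e he => by
      simp only [Finset.mem_range, not_lt] at he
      obtain ⟨j, rfl⟩ := Nat.exists_eq_add_of_le' he
      simp only [gr_p3 r hp j, hφ])
  have e : ∑ e ∈ Finset.range 3, φ (gr r (p^e)) (p^e) =
    φ 1 1 + φ (Hr r p - 1) p + φ (- Hr r p) (p^2) := by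
    rw [Finset.sum_range_succ, Finset.sum_range_succ, Finset.sum_range_one, gr_p1 r hp, gr_p2 r hp]
    simp [(gr_mult r).1]
  rwa [e] at h

noncomputable def fr (r k : ℕ) : ℝ := |gr r k| * (k:ℝ) ^ (-(2/3) : ℝ)

lemma fr_nonneg (r k : ℕ) : 0 ≤ fr r k := by unfold fr; positivity

lemma fr_zero (r : ℕ) : fr r 0 = 0 := by simp [fr]

lemma fr_one (r : ℕ) : fr r 1 = 1 := by simp [fr, (gr_mult r).1]

lemma fr_mul (r : ℕ) {m n : ℕ} (h : m.Coprime n) : fr r (m * n) = fr r m * fr r n := by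
  unfold fr
  rw [(gr_mult r).2 h, abs_mul]
  push_cast
  rw [Real.mul_rpow (by positivity) (by positivity)]
  ring

lemma fr_local (r : ℕ) {p : ℕ} (hp : p.Prime) :
    HasSum (fun e => fr r (p^e)) (1 + |Hr r p - 1| * (p:ℝ) ^ (-(2/3) : ℝ)
      + |Hr r p| * (p:ℝ) ^ (-(4/3) : ℝ)) := by
  have h := gr_tsum r hp (fun a n => |a| * (n:ℝ) ^ (-(2/3) : ℝ)) (by simp)
  have e : ((p:ℝ)^2) ^ (-(2/3) : ℝ) = (p:ℝ) ^ (-(4/3) : ℝ) := by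
    rw [← Real.rpow_natCast, ← Real.rpow_mul (by positivity)]
    norm_num
  simpa [e, fr] using h

lemma fr_local_le (r : ℕ) {p : ℕ} (hp : p.Prime) :
    ∑' e, fr r (p^e) ≤ (if p ∣ r then 2 else 1) * Real.exp (6 * (1 / (p:ℝ) ^ (4/3 : ℝ))) := by
  rw [(fr_local r hp).tsum_eq, Hr_prime r hp]
  have hp2 : (2:ℝ) ≤ p := by exact_mod_cast hp.two_le
  have hp0 : (0:ℝ) < p := by linarith
  have e4 : (p:ℝ) ^ (-(4/3) : ℝ) = 1 / (p:ℝ) ^ (4/3 : ℝ) := by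
    rw [Real.rpow_neg hp0.le, one_div]
  rw [← e4]
  set a := (p:ℝ) ^ (-(4/3) : ℝ) with ha
  set b := (p:ℝ) ^ (-(2/3) : ℝ) with hb
  have ha0 : 0 < a := Real.rpow_pos_of_pos hp0 _
  have hb0 : 0 < b := Real.rpow_pos_of_pos hp0 _
  have hb1 : b ≤ 1 := Real.rpow_le_one_of_one_le_of_nonpos (by linarith) (by norm_num)
  have hab : a = b ^ 2 := by
    rw [ha, hb, ← Real.rpow_natCast, ← Real.rpow_mul hp0.le]; norm_num
  have hexp := Real.add_one_le_exp (6 * a)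
  by_cases h : p ∣ r
  · simp only [h, if_true]
    norm_num
    linarith
  · simp only [h, if_false, one_mul]
    have hq : (p:ℝ)^2 - 2 > 0 := by nlinarith
    have hH : (1 - 2 / (p:ℝ)^2)⁻¹ = 1 + 2 / ((p:ℝ)^2 - 2) := by
      have : 1 - 2 / (p:ℝ)^2 = ((p:ℝ)^2 - 2) / (p:ℝ)^2 := by field_simp
      rw [this]
      field_simp
      ring
    have hb3 : b ^ 3 = ((p:ℝ)^2)⁻¹ := by
      rw [hb, ← Real.rpow_natCast, ← Real.rpow_mul hp0.le, ← Real.rpow_natCast,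
        ← Real.rpow_neg hp0.le]
      norm_num
    have h3 : 2 / ((p:ℝ)^2 - 2) ≤ 4 * b ^ 3 := by
      rw [hb3, ← div_eq_mul_inv, div_le_div_iff₀ hq (by positivity)]
      nlinarith
    have h4 : 4 * b^3 ≤ 4 * a := by
      rw [hab]; nlinarith [sq_nonneg b]
    have hδ : 0 < 2 / ((p:ℝ)^2 - 2) := by positivity
    have h5 : 2 / ((p:ℝ)^2 - 2) ≤ 1 := by
      rw [div_le_one hq]; nlinarith
    rw [hH, add_sub_cancel_left, abs_of_pos hδ, abs_of_pos (by linarith)]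
    have h6 : 2 / ((p:ℝ)^2 - 2) * b ≤ 4 * a := by nlinarith
    have h7 : (1 + 2 / ((p:ℝ)^2 - 2)) * a ≤ 2 * a := by nlinarith
    linarith

lemma two_pow_le_div (r : ℕ) (hr : 1 ≤ r) : (2:ℝ) ^ r.primeFactors.card ≤ (r.divisors.card : ℝ) := by
  have : 2 ^ r.primeFactors.card ≤ r.divisors.card := by
    rw [Nat.card_divisors (by omega), ← Finset.prod_const]
    refine Finset.prod_le_prod' fun p hp => ?_
    have h := (Nat.prime_of_mem_primeFactors hp).factorization_pos_of_dvd (by omega)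
      (Nat.dvd_of_mem_primeFactors hp)
    omega
  exact_mod_cast this

noncomputable def Ce : ℝ := Real.exp (∑' n : ℕ, 6 * (1 / (n:ℝ) ^ (4/3 : ℝ)))

lemma fr_range (r : ℕ) (hr : 1 ≤ r) (N : ℕ) :
    ∑ k ∈ Finset.range N, fr r k ≤ Ce * r.divisors.card := by
  have hs : Summable (fun n : ℕ => 6 * (1 / (n:ℝ) ^ (4/3 : ℝ))) :=
    (Real.summable_one_div_nat_rpow.2 (by norm_num)).mul_left _
  have h := (EulerProduct.summable_and_hasSum_smoothNumbers_prod_primesBelow_tsum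
    (f := fr r) (fr_one r) (fun {m n} h => fr_mul r h) (fun {p} hp => by
      have := (fr_local r hp).summable
      simpa [abs_of_nonneg (fr_nonneg _ _)] using this) N).2
  have h' : HasSum ((N.smoothNumbers).indicator (fr r)) (∏ p ∈ N.primesBelow, ∑' n : ℕ, fr r (p ^ n)) :=
    (hasSum_subtype_iff_indicator).1 h
  have h1 : ∑ k ∈ Finset.range N, fr r k ≤ ∏ p ∈ N.primesBelow, ∑' n : ℕ, fr r (p ^ n) := by
    refine le_trans (le_of_eq ?_) (sum_le_hasSum (Finset.range N)
      (fun k _ => indicator_nonneg (fun k _ => fr_nonneg r k) k) h')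
    refine Finset.sum_congr rfl fun k hk => ?_
    rcases Nat.eq_zero_or_pos k with rfl | hk0
    · rw [fr_zero]
      by_cases h0 : 0 ∈ N.smoothNumbers
      · rw [indicator_of_mem h0, fr_zero]
      · rw [indicator_of_notMem h0]
    · rw [indicator_of_mem (Nat.mem_smoothNumbers_of_lt hk0 (Finset.mem_range.1 hk))]
  refine h1.trans ?_
  calc ∏ p ∈ N.primesBelow, ∑' n : ℕ, fr r (p ^ n)
      ≤ ∏ p ∈ N.primesBelow, ((if p ∣ r then 2 else 1) *
          Real.exp (6 * (1 / (p:ℝ) ^ (4/3 : ℝ)))) := by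
        refine Finset.prod_le_prod (fun p _ => tsum_nonneg fun _ => fr_nonneg _ _) fun p hp => ?_
        exact fr_local_le r (Nat.prime_of_mem_primesBelow hp)
    _ = (∏ p ∈ N.primesBelow, (if p ∣ r then (2:ℝ) else 1)) *
          Real.exp (∑ p ∈ N.primesBelow, 6 * (1 / (p:ℝ) ^ (4/3 : ℝ))) := by
        rw [Finset.prod_mul_distrib, Real.exp_sum]
    _ ≤ (2:ℝ) ^ r.primeFactors.card * Ce := by
        gcongr
        · rw [← Finset.prod_filter, Finset.prod_const]
          refine pow_le_pow_right₀ (by norm_num) (Finset.card_le_card fun p hp => ?_)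
          rw [Finset.mem_filter] at hp
          exact Nat.mem_primeFactors.2 ⟨Nat.prime_of_mem_primesBelow hp.1, hp.2, by omega⟩
        · unfold Ce
          apply Real.exp_le_exp.2
          exact hs.sum_le_tsum _ (fun n _ => by positivity)
    _ ≤ _ := by
        rw [mul_comm]
        have : 0 < Ce := Real.exp_pos _
        have := two_pow_le_div r hr
        gcongr

lemma fr_summable (r : ℕ) (hr : 1 ≤ r) : Summable (fr r) :=
  summable_of_sum_range_le (fr_nonneg r) (fr_range r hr)

lemma fr_tsum_le (r : ℕ) (hr : 1 ≤ r) : ∑' k, fr r k ≤ Ce * r.divisors.card :=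
  Real.tsum_le_of_sum_range_le (fr_nonneg r) (fr_range r hr)

lemma gk_summable (r : ℕ) (hr : 1 ≤ r) : Summable fun k : ℕ => ‖gr r k / k‖ := by
  refine Summable.of_nonneg_of_le (fun _ => norm_nonneg _) (fun k => ?_) (fr_summable r hr)
  rcases Nat.eq_zero_or_pos k with rfl | hk
  · simp [fr]
  · have hk1 : (1:ℝ) ≤ k := by exact_mod_cast hk
    rw [norm_div, Real.norm_eq_abs, Real.norm_natCast, fr, div_eq_mul_inv]
    gcongr
    rw [← Real.rpow_neg_one]
    exact Real.rpow_le_rpow_of_exponent_le hk1 (by norm_num)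

lemma gk_euler (r : ℕ) (hr : 1 ≤ r) :
    HasProd (fun p : Nat.Primes => (1 - 1 / ((p:ℕ):ℝ)) * (1 + Hr r p / ((p:ℕ):ℝ)))
      (∑' k : ℕ, gr r k / k) := by
  have h := EulerProduct.eulerProduct_hasProd (f := fun k : ℕ => gr r k / k)
    (by simp [(gr_mult r).1]) (fun {m n} hmn => by
      rw [(gr_mult r).2 hmn]; push_cast; rw [mul_div_mul_comm]) (gk_summable r hr) (by simp)
  convert! h using 2 with p
  have := gr_tsum r p.2 (fun a n => a / n) (by simp)
  rw [this.tsum_eq]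
  have hp0 : ((p:ℕ):ℝ) ≠ 0 := by exact_mod_cast p.2.ne_zero
  push_cast
  field_simp
  ring

noncomputable def Cp : ℝ := ∏' p : Nat.Primes,
      ((((p : ℕ) : ℝ) ^ 3 - 3 * ((p : ℕ) : ℝ) + 2) /
        (((p : ℕ) : ℝ) * (((p : ℕ) : ℝ) ^ 2 - 2)))

lemma gk_tsum (r : ℕ) (hr : 1 ≤ r) : ∑' k : ℕ, gr r k / k =
    Cp * ∏ p ∈ r.primeFactors, (1 + (p : ℝ) * ((p : ℝ) ^ 2 - 2)⁻¹)⁻¹ := by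
  have h1 := gk_euler 1 le_rfl
  have hfac : ∀ p : Nat.Primes, (1 - 1 / ((p:ℕ):ℝ)) * (1 + Hr 1 p / ((p:ℕ):ℝ)) =
      ((((p : ℕ) : ℝ) ^ 3 - 3 * ((p : ℕ) : ℝ) + 2) /
        (((p : ℕ) : ℝ) * (((p : ℕ) : ℝ) ^ 2 - 2))) := by
    intro p
    have hp2 : (2:ℝ) ≤ (p:ℕ) := by exact_mod_cast p.2.two_le
    have hq : ((p:ℕ):ℝ)^2 - 2 ≠ 0 := by nlinarith
    have hp0 : ((p:ℕ):ℝ) ≠ 0 := by linarith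
    rw [Hr_prime 1 p.2, if_neg (by simpa using p.2.one_lt.ne')]
    have : 1 - 2 / ((p:ℕ):ℝ)^2 = (((p:ℕ):ℝ)^2 - 2) / ((p:ℕ):ℝ)^2 := by field_simp
    rw [this]
    field_simp
    ring
  have hCp : ∑' k : ℕ, gr 1 k / k = Cp := by
    rw [← h1.tprod_eq, Cp]
    exact tprod_congr hfac
  rw [hCp] at h1
  let ρ : ℕ → ℝ := fun p => if p ∣ r then (1 + (p : ℝ) * ((p : ℝ) ^ 2 - 2)⁻¹)⁻¹ else 1
  let s : Finset Nat.Primes := r.primeFactors.subtype Nat.Prime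
  have h2 : HasProd (fun p : Nat.Primes => ρ p) (∏ p ∈ s, ρ p) := by
    apply hasProd_prod_of_ne_finset_one
    intro p hp
    have : ¬ (p:ℕ) ∣ r := by
      intro hd
      apply hp
      exact Finset.mem_subtype.2 (Nat.mem_primeFactors.2 ⟨p.2, hd, by omega⟩)
    simp [ρ, this]
  have h3 : ∏ p ∈ s, ρ p = ∏ p ∈ r.primeFactors, (1 + (p : ℝ) * ((p : ℝ) ^ 2 - 2)⁻¹)⁻¹ := by
    refine (Finset.prod_subtype_of_mem (p := Nat.Prime) ρ
      (fun p hp => Nat.prime_of_mem_primeFactors hp)).trans ?_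
    refine Finset.prod_congr rfl fun p hp => ?_
    simp [ρ, Nat.dvd_of_mem_primeFactors hp]
  rw [h3] at h2
  refine (gk_euler r hr).unique ?_
  convert! h1.mul h2 using 2 with p
  have hp2 : (2:ℝ) ≤ (p:ℕ) := by exact_mod_cast p.2.two_le
  have hq : 0 < ((p:ℕ):ℝ)^2 - 2 := by nlinarith
  have hp0 : 0 < ((p:ℕ):ℝ) := by linarith
  rw [Hr_prime r p.2, Hr_prime 1 p.2, if_neg (by simpa using p.2.one_lt.ne' : ¬ (p:ℕ) ∣ 1)]
  by_cases h : (p:ℕ) ∣ r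
  · simp only [h, if_true, ρ]
    have : (1 - 2 / ((p:ℕ):ℝ)^2)⁻¹ / ((p:ℕ):ℝ) = ((p:ℕ):ℝ) * (((p:ℕ):ℝ)^2 - 2)⁻¹ := by
      have : 1 - 2 / ((p:ℕ):ℝ)^2 = (((p:ℕ):ℝ)^2 - 2) / ((p:ℕ):ℝ)^2 := by field_simp
      rw [this]
      field_simp
    rw [this, mul_assoc, mul_inv_cancel₀ (by positivity)]
    simp
  · simp only [h, if_false, ρ, mul_one]

lemma phi_summable {Y : ℝ} (hY : 0 ≤ Y) (r : ℕ) (hr : 1 ≤ r) :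
    Summable fun x : ℕ × ℕ => gr r x.1 * Fs (Y / ((x.1 * x.2 : ℕ):ℝ)^2) := by
  have h1 := gk_summable r hr
  have h2 : Summable fun m : ℕ => Y / 2 * (1 / (m:ℝ)^2) :=
    (Real.summable_one_div_nat_pow.2 (by norm_num)).mul_left _
  have h3 := h1.mul_of_nonneg h2 (fun _ => norm_nonneg _) (fun _ => by positivity)
  refine Summable.of_norm_bounded h3 fun x => ?_
  obtain ⟨k, m⟩ := x
  rcases Nat.eq_zero_or_pos k with rfl | hk
  · simp
  have hk1 : (1:ℝ) ≤ k := by exact_mod_cast hk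
  simp only
  rw [norm_mul, norm_div, Real.norm_natCast, Real.norm_of_nonneg (Fs_nonneg _)]
  have h4 := Fs_div_le hY ((k*m : ℕ):ℝ)
  calc ‖gr r k‖ * Fs (Y / ((k * m : ℕ):ℝ)^2) ≤ ‖gr r k‖ * (Y / 2 * (1 / ((k*m:ℕ):ℝ)^2)) := by gcongr
    _ = ‖gr r k‖ / ((k:ℝ)^2) * (Y / 2 * (1 / (m:ℝ)^2)) := by
      push_cast
      rw [mul_pow, one_div, mul_inv]
      ring
    _ ≤ _ := by
      gcongr
      nlinarith

lemma G_eq {Y : ℝ} (hY : 0 ≤ Y) (r : ℕ) (hr : 1 ≤ r) :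
    Gfun Y r = ∑' k : ℕ, gr r k * Sx (Y / (k:ℝ)^2) := by
  have hs := phi_summable hY r hr
  have h1 := hs.hasSum.tsum_fiberwise (fun p : ℕ × ℕ => p.1 * p.2)
  have hG : Gfun Y r = ∑' d : ℕ, Hr r d * Fs (Y / (d:ℝ)^2) := by
    unfold Gfun
    refine tsum_congr fun d => ?_
    rcases Nat.eq_zero_or_pos d with rfl | hd
    · simp
    · rw [Hr_apply, Fs]
      have : 1 ≤ d := hd
      by_cases h : d.Coprime r <;> simp [h, this]
  have h2 : ∀ n : ℕ, (∑' b : (fun p : ℕ × ℕ => p.1 * p.2) ⁻¹' {n},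
      gr r b.val.1 * Fs (Y / ((b.val.1 * b.val.2 : ℕ):ℝ)^2)) = Hr r n * Fs (Y / (n:ℝ)^2) := by
    intro n
    rcases eq_or_ne n 0 with rfl | hn
    · have : ∀ b : (fun p : ℕ × ℕ => p.1 * p.2) ⁻¹' {0},
          gr r b.val.1 * Fs (Y / ((b.val.1 * b.val.2 : ℕ):ℝ)^2) = 0 := by
        rintro ⟨b, hb⟩
        have hb : b.1 * b.2 = 0 := hb
        simp only [hb]
        simp [Fs_zero]
      rw [tsum_congr this, tsum_zero]
      simp
    · rw [show (fun p : ℕ × ℕ ↦ p.1 * p.2) ⁻¹' {n} = n.divisorsAntidiagonal by ext; simp [hn],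
        Finset.tsum_subtype' n.divisorsAntidiagonal
          fun p : ℕ × ℕ => gr r p.1 * Fs (Y / ((p.1 * p.2 : ℕ):ℝ)^2)]
      rw [← gr_sum r n, Finset.sum_mul, ← Nat.sum_divisorsAntidiagonal
        (fun k _ => gr r k * Fs (Y / (n:ℝ)^2))]
      refine Finset.sum_congr rfl fun p hp => ?_
      rw [(Nat.mem_divisorsAntidiagonal.1 hp).1]
  simp only [h2] at h1
  rw [hG, h1.tsum_eq, hs.tsum_prod]
  refine tsum_congr fun k => ?_
  simp only
  rw [tsum_mul_left, Sx]
  congr 1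
  refine tsum_congr fun m => ?_
  push_cast
  rw [mul_pow, div_div]

theorem statement8 :
    ∃ A : ℝ, 0 < A ∧ ∀ (Y : ℝ) (r : ℕ), 1 ≤ Y → 1 ≤ r →
      |Gfun Y r - Cprime * (∏ p ∈ r.primeFactors,
            (1 + (p : ℝ) * ((p : ℝ) ^ 2 - 2)⁻¹)⁻¹) * Y ^ ((1 : ℝ)/2)|
        ≤ A * (r.divisors.card : ℝ) * Y ^ ((1 : ℝ)/3) := by
  obtain ⟨C, hC, hCS⟩ := Sx_err
  have hCe : 0 < Ce := Real.exp_pos _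
  refine ⟨C * Ce, by positivity, fun Y r hY hr => ?_⟩
  have hY0 : 0 < Y := by linarith
  have hterm : ∀ k : ℕ, ‖gr r k * Sx (Y / (k:ℝ)^2) - Kc * √Y * (gr r k / k)‖ ≤
      C * Y ^ ((1:ℝ)/3) * fr r k := by
    intro k
    rcases Nat.eq_zero_or_pos k with rfl | hk
    · simp [fr]
    have hk0 : (0:ℝ) < k := by exact_mod_cast hk
    have h := hCS (Y / (k:ℝ)^2) (by positivity)
    have e1 : √(Y / (k:ℝ)^2) = √Y / k := by
      rw [Real.sqrt_div hY0.le, Real.sqrt_sq hk0.le]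
    have e2 : (Y / (k:ℝ)^2) ^ (1/3 : ℝ) = Y ^ ((1:ℝ)/3) * (k:ℝ) ^ (-(2/3) : ℝ) := by
      rw [div_eq_mul_inv, Real.mul_rpow hY0.le (by positivity), ← Real.rpow_natCast,
        ← Real.rpow_neg hk0.le, ← Real.rpow_mul hk0.le]
      norm_num
    rw [e1, e2] at h
    rw [show gr r k * Sx (Y / (k:ℝ)^2) - Kc * √Y * (gr r k / k) =
      gr r k * (Sx (Y / (k:ℝ)^2) - Kc * (√Y / k)) by ring, norm_mul, Real.norm_eq_abs,
      Real.norm_eq_abs, fr]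
    calc _ ≤ |gr r k| * (C * (Y ^ ((1:ℝ)/3) * (k:ℝ) ^ (-(2/3) : ℝ))) := by gcongr
      _ = _ := by ring
  have hfs := (fr_summable r hr).mul_left (C * Y ^ ((1:ℝ)/3))
  have hs1 : Summable fun k : ℕ => gr r k * Sx (Y / (k:ℝ)^2) - Kc * √Y * (gr r k / k) :=
    Summable.of_norm_bounded hfs hterm
  have hs2 : Summable fun k : ℕ => Kc * √Y * (gr r k / k) :=
    ((gk_summable r hr).of_norm).mul_left _
  have hs3 : Summable fun k : ℕ => gr r k * Sx (Y / (k:ℝ)^2) := by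
    simpa using hs1.add hs2
  have hmain : Gfun Y r - Cprime * (∏ p ∈ r.primeFactors,
            (1 + (p : ℝ) * ((p : ℝ) ^ 2 - 2)⁻¹)⁻¹) * Y ^ ((1 : ℝ)/2) =
      ∑' k : ℕ, (gr r k * Sx (Y / (k:ℝ)^2) - Kc * √Y * (gr r k / k)) := by
    rw [hs3.tsum_sub hs2, tsum_mul_left, gk_tsum r hr, G_eq hY0.le r hr, ← Real.sqrt_eq_rpow,
      show Cprime = Kc * Cp from rfl]
    ring
  rw [hmain, ← Real.norm_eq_abs]
  refine (tsum_of_norm_bounded hfs.hasSum hterm).trans ?_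
  rw [tsum_mul_left]
  calc _ ≤ C * Y ^ ((1:ℝ)/3) * (Ce * r.divisors.card) := by
        have := fr_tsum_le r hr
        gcongr
    _ = _ := by ring
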